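/- Let ℓ : ℝ^n × ℝ^m → ℝ and g : ℝ^n × ℝ^m → ℝ^m be C² on a neighborhood of z* = (p*, q*) with g(z*) = 0, and suppose the m×m Jacobian ∇_q g(z*) is invertible. Let P* ⊆ ℝ^n be an open neighborhood of p* and w : P* → ℝ^n × ℝ^m a C² function with w(p*) = z*, g(w(p)) = 0 for all p ∈ P*, and Jacobian ∇w(p*) = [I_n ; −(∇_q g(z*))⁻¹ ∇_p g(z*)]. Suppose λ* ∈ ℝ^m satisfies ∇ℓ(z*) + (∇g(z*))ᵀ λ* = 0, and that vᵀ [∇²ℓ(z*) + Σ_{s=1}^{m} λ*_s ∇²g_s(z*)] v < 0 for every nonzero v ∈ ℝ^{n+m} with ∇g(z*) v = 0. Define the bordered Hessian H_L as the (n+2m)×(n+2m) block matrix H_L = [[∇²ℓ(z*) + Σ_{s} λ*_s ∇²g_s(z*), (∇g(z*))ᵀ], [∇g(z*), 0]], and let ℓ̃(p) = ℓ(w(p)). Then both the n×n Hessian ∇²ℓ̃(p*) and H_L are invertible, and (∇²ℓ̃(p*))⁻¹ equals the submatrix of H_L⁻¹ formed by its first n rows and first n columns. -/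

import Mathlib

open Matrix

noncomputable section

/-- Basis direction indexed by `Fin n ⊕ Fin m` in the product space `ℝⁿ × ℝᵐ`. -/
def dir (n m : ℕ) (k : Fin n ⊕ Fin m) : (Fin n → ℝ) × (Fin m → ℝ) :=
  Sum.elim (fun i => (Pi.single i 1, 0)) (fun j => (0, Pi.single j 1)) k

/-- Gradient (vector of first partial derivatives) of `ℓ : ℝⁿ × ℝᵐ → ℝ` at `z`. -/
def grad (n m : ℕ) (ℓ : (Fin n → ℝ) × (Fin m → ℝ) → ℝ)
    (z : (Fin n → ℝ) × (Fin m → ℝ)) : Fin n ⊕ Fin m → ℝ :=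
  fun k => fderiv ℝ ℓ z (dir n m k)

/-- The `(n+m) × (n+m)` Hessian matrix of `f : ℝⁿ × ℝᵐ → ℝ` at `z`. -/
def hess (n m : ℕ) (f : (Fin n → ℝ) × (Fin m → ℝ) → ℝ)
    (z : (Fin n → ℝ) × (Fin m → ℝ)) : Matrix (Fin n ⊕ Fin m) (Fin n ⊕ Fin m) ℝ :=
  fun k r => iteratedFDeriv ℝ 2 f z ![dir n m k, dir n m r]

/-- The `m × (n+m)` Jacobian matrix of `g : ℝⁿ × ℝᵐ → ℝᵐ` at `z`. -/
def jac (n m : ℕ) (g : (Fin n → ℝ) × (Fin m → ℝ) → Fin m → ℝ)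
    (z : (Fin n → ℝ) × (Fin m → ℝ)) : Matrix (Fin m) (Fin n ⊕ Fin m) ℝ :=
  fun s k => fderiv ℝ g z (dir n m k) s

/-- The `(n+m) × n` Jacobian matrix of `w : ℝⁿ → ℝⁿ × ℝᵐ` at `p`. -/
def jacW (n m : ℕ) (w : (Fin n → ℝ) → (Fin n → ℝ) × (Fin m → ℝ)) (p : Fin n → ℝ) :
    Matrix (Fin n ⊕ Fin m) (Fin n) ℝ :=
  fun k j => Sum.elim (fun i => (fderiv ℝ w p (Pi.single j 1)).1 i)
    (fun i => (fderiv ℝ w p (Pi.single j 1)).2 i) k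

/-- The `n × n` Hessian matrix of `f : ℝⁿ → ℝ` at `p`. -/
def hessRed (n : ℕ) (f : (Fin n → ℝ) → ℝ) (p : Fin n → ℝ) :
    Matrix (Fin n) (Fin n) ℝ :=
  fun i j => iteratedFDeriv ℝ 2 f p ![Pi.single i 1, Pi.single j 1]


theorem aux_alg {n m : ℕ} (A : Matrix (Fin n ⊕ Fin m) (Fin n ⊕ Fin m) ℝ)
    (G : Matrix (Fin m) (Fin n ⊕ Fin m) ℝ) (W : Matrix (Fin n ⊕ Fin m) (Fin n) ℝ)
    (hGq : IsUnit (G.submatrix id Sum.inr).det)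
    (hW : W = Matrix.fromRows (1 : Matrix (Fin n) (Fin n) ℝ)
        (-((G.submatrix id Sum.inr)⁻¹ * G.submatrix id Sum.inl)))
    (hs : ∀ v : Fin n ⊕ Fin m → ℝ, v ≠ 0 → G.mulVec v = 0 → v ⬝ᵥ A.mulVec v < 0) :
    IsUnit (Wᵀ * A * W).det ∧ IsUnit (Matrix.fromBlocks A Gᵀ G 0).det ∧
    (Wᵀ * A * W)⁻¹ = (Matrix.fromBlocks A Gᵀ G 0)⁻¹.submatrix
        (fun i : Fin n => Sum.inl (Sum.inl i)) (fun j : Fin n => Sum.inl (Sum.inl j)) := by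
  set Gq := G.submatrix id Sum.inr with hGqd
  set Gp := G.submatrix id Sum.inl with hGpd
  have hG : G = Matrix.fromCols Gp Gq := by
    ext i (j | j) <;> simp [hGqd, hGpd]
  have hGW : G * W = 0 := by
    rw [hG, hW, Matrix.fromCols_mul_fromRows]
    simp [Matrix.mul_nonsing_inv_cancel_left _ _ hGq]
  have hWt : ∀ x, W.mulVec x = 0 → x = 0 := by
    intro x hx
    rw [hW, Matrix.fromRows_mulVec] at hx
    ext i
    have := congrFun hx (Sum.inl i)
    simpa using this
  have hR : IsUnit (Wᵀ * A * W).det := by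
    rw [← Matrix.isUnit_iff_isUnit_det, ← Matrix.mulVec_injective_iff_isUnit]
    refine (injective_iff_map_eq_zero (Matrix.mulVecLin (Wᵀ * A * W))).2 ?_
    intro x hx
    by_contra hne
    have h1 := hs (W.mulVec x) (fun h => hne (hWt x h))
      (by rw [Matrix.mulVec_mulVec, hGW, Matrix.zero_mulVec])
    have h2 : x ⬝ᵥ (Wᵀ * A * W).mulVec x = 0 := by
      rw [Matrix.mulVecLin_apply] at hx
      rw [hx, dotProduct_zero]
    rw [Matrix.mul_assoc, ← Matrix.mulVec_mulVec, Matrix.dotProduct_mulVec,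
      Matrix.vecMul_transpose, ← Matrix.mulVec_mulVec] at h2
    linarith
  have hH : IsUnit (Matrix.fromBlocks A Gᵀ G 0).det := by
    rw [← Matrix.isUnit_iff_isUnit_det, ← Matrix.mulVec_injective_iff_isUnit]
    refine (injective_iff_map_eq_zero (Matrix.mulVecLin (Matrix.fromBlocks A Gᵀ G 0))).2 ?_
    intro x hx
    rw [Matrix.mulVecLin_apply, Matrix.fromBlocks_mulVec] at hx
    have e1 : A.mulVec (x ∘ Sum.inl) + Gᵀ.mulVec (x ∘ Sum.inr) = 0 := by
      ext i
      simpa using congrFun hx (Sum.inl i)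
    have e2 : G.mulVec (x ∘ Sum.inl) = 0 := by
      ext i
      simpa using congrFun hx (Sum.inr i)
    have hv : x ∘ Sum.inl = 0 := by
      by_contra hne
      have h1 := hs _ hne e2
      have h2 : (x ∘ Sum.inl) ⬝ᵥ (A.mulVec (x ∘ Sum.inl) + Gᵀ.mulVec (x ∘ Sum.inr)) = 0 := by
        rw [e1, dotProduct_zero]
      rw [dotProduct_add, Matrix.dotProduct_mulVec _ Gᵀ, Matrix.vecMul_transpose, e2,
        zero_dotProduct] at h2
      linarith
    have hmu : x ∘ Sum.inr = 0 := by
      rw [hv, Matrix.mulVec_zero, zero_add] at e1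
      have h3 : Gqᵀ.mulVec (x ∘ Sum.inr) = 0 := by
        ext i
        exact congrFun e1 (Sum.inr i)
      have h4 : IsUnit Gqᵀ := by
        rw [Matrix.isUnit_iff_isUnit_det, Matrix.det_transpose]; exact hGq
      exact Matrix.mulVec_injective_of_isUnit h4 (by rw [h3, Matrix.mulVec_zero])
    ext (i | i)
    · exact congrFun hv i
    · exact congrFun hmu i
  refine ⟨hR, hH, ?_⟩
  set K := (Matrix.fromBlocks A Gᵀ G 0)⁻¹ with hK
  have hKK : Matrix.fromBlocks A Gᵀ G 0 * K = 1 := Matrix.mul_nonsing_inv _ hH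
  rw [← Matrix.fromBlocks_toBlocks K, Matrix.fromBlocks_multiply, ← Matrix.fromBlocks_one] at hKK
  obtain ⟨k1, -, k3, -⟩ := Matrix.fromBlocks_inj.1 hKK
  rw [Matrix.zero_mul, add_zero] at k3
  set X := K.toBlocks₁₁ with hX
  have hXW : X = W * X.submatrix Sum.inl id := by
    have hX' : X = Matrix.fromRows (X.submatrix Sum.inl id) (X.submatrix Sum.inr id) := by
      ext (i | i) j <;> simp
    have k3' := k3
    rw [hG, hX', Matrix.fromCols_mul_fromRows] at k3'
    have h5 : X.submatrix Sum.inr id = -(Gq⁻¹ * Gp) * X.submatrix Sum.inl id := by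
      rw [Matrix.neg_mul, Matrix.mul_assoc, eq_neg_of_add_eq_zero_left k3', Matrix.mul_neg, neg_neg,
        Matrix.nonsing_inv_mul_cancel_left _ _ hGq]
    rw [hW, Matrix.fromRows_mul, Matrix.one_mul, ← h5]
    exact hX'
  have k5 : (Wᵀ * A * W) * X.submatrix Sum.inl id = Wᵀ := by
    have h6 : Wᵀ * Gᵀ = 0 := by rw [← Matrix.transpose_mul, hGW, Matrix.transpose_zero]
    have h7 := congrArg (fun M => Wᵀ * M) k1
    simp only [Matrix.mul_add, ← Matrix.mul_assoc, h6, Matrix.zero_mul, add_zero,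
      Matrix.mul_one] at h7
    rw [Matrix.mul_assoc _ W, ← hXW, h7]
  refine Matrix.inv_eq_right_inv ?_
  have h8 : (Wᵀ * A * W) * (X.submatrix Sum.inl Sum.inl) = Wᵀ.submatrix id Sum.inl := by
    have := congrArg (fun M => M.submatrix id (Sum.inl : Fin n → Fin n ⊕ Fin m)) k5
    exact this
  have h9 : Wᵀ.submatrix id Sum.inl = (1 : Matrix (Fin n) (Fin n) ℝ) := by
    rw [hW]; ext i j; simp [Matrix.one_apply, eq_comm]
  rw [← h9, ← h8]; rfl

theorem aux_chain {E F : Type*} [NormedAddCommGroup E] [NormedSpace ℝ E]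
    [NormedAddCommGroup F] [NormedSpace ℝ F] (f : F → ℝ) (w : E → F) (p : E)
    (hf : ContDiffAt ℝ 2 f (w p)) (hw : ContDiffAt ℝ 2 w p) (h0 : fderiv ℝ f (w p) = 0)
    (u v : E) :
    iteratedFDeriv ℝ 2 (fun x => f (w x)) p ![u, v] =
      iteratedFDeriv ℝ 2 f (w p) ![fderiv ℝ w p u, fderiv ℝ w p v] := by
  simp only [iteratedFDeriv_two_apply, Matrix.cons_val_zero, Matrix.cons_val_one]
  have hev : fderiv ℝ (fun x => f (w x)) =ᶠ[nhds p]
      fun x => (fderiv ℝ f (w x)).comp (fderiv ℝ w x) := by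
    have a1 := hw.eventually (by simp)
    have a2 := hw.continuousAt.eventually (hf.eventually (by simp))
    filter_upwards [a1, a2] with x h1 h2
    exact fderiv_comp x (h2.differentiableAt (by simp)) (h1.differentiableAt (by simp))
  have d1 : DifferentiableAt ℝ (fderiv ℝ f) (w p) :=
    (hf.fderiv_right (m := 1) (by norm_num)).differentiableAt (by simp)
  have d2 : DifferentiableAt ℝ (fderiv ℝ w) p :=
    (hw.fderiv_right (m := 1) (by norm_num)).differentiableAt (by simp)
  have d3 : DifferentiableAt ℝ w p := hw.differentiableAt (by simp)
  have hd := (d1.hasFDerivAt.comp p d3.hasFDerivAt).clm_comp d2.hasFDerivAt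
  have hd' : HasFDerivAt (fun x => (fderiv ℝ f (w x)).comp (fderiv ℝ w x)) _ p := hd
  rw [hev.fderiv_eq, hd'.fderiv]
  simp [h0]

theorem aux_expand (n m : ℕ) (z : (Fin n → ℝ) × (Fin m → ℝ)) :
    z = ∑ k, (Sum.elim z.1 z.2 k) • dir n m k := by
  rw [Fintype.sum_sum_type]
  ext i
  · simp [dir, Finset.sum_apply, Pi.single_apply, Prod.fst_sum]
  · simp [dir, Finset.sum_apply, Pi.single_apply, Prod.snd_sum]

theorem aux_lag (n m : ℕ) (ℓ : (Fin n → ℝ) × (Fin m → ℝ) → ℝ)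
    (g : (Fin n → ℝ) × (Fin m → ℝ) → Fin m → ℝ) (z : (Fin n → ℝ) × (Fin m → ℝ))
    (hℓ : ContDiffAt ℝ 2 ℓ z) (hg : ContDiffAt ℝ 2 g z) (lam : Fin m → ℝ) :
    hess n m (fun z => ℓ z + ∑ s, lam s * g z s) z =
      hess n m ℓ z + ∑ s, lam s • hess n m (fun z => g z s) z := by
  have hgs : ∀ s, ContDiffAt ℝ 2 (fun z => g z s) z := contDiffAt_pi.1 hg
  have hgs' : ∀ s, ContDiffAt ℝ 2 (fun z => lam s * g z s) z :=
    fun s => contDiffAt_const.mul (hgs s)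
  ext k r
  rw [Matrix.add_apply, Matrix.sum_apply]
  simp only [hess, Matrix.smul_apply]
  have h1 : iteratedFDeriv ℝ 2 (fun z => ℓ z + ∑ s, lam s * g z s) z =
      iteratedFDeriv ℝ 2 ℓ z + ∑ s, lam s • iteratedFDeriv ℝ 2 (fun z => g z s) z := by
    have e : (fun z => ℓ z + ∑ s, lam s * g z s) = ℓ + ∑ s, lam s • (fun z => g z s) := by
      ext z; simp
    have hsum : ContDiffAt ℝ 2 (∑ s, lam s • (fun z => g z s)) z := by
      have h := ContDiffAt.sum (s := Finset.univ) fun s _ => hgs' s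
      convert h using 1
      ext z; simp
    rw [e, iteratedFDeriv_add_apply hℓ hsum,
      iteratedFDeriv_sum_apply (f := fun s => lam s • (fun z => g z s)) (fun s _ => hgs' s)]
    congr 1
    exact Finset.sum_congr rfl fun s _ => iteratedFDeriv_const_smul_apply (hgs s)
  rw [h1]
  simp [hess]

/-- Main theorem: equivalence of inverse Hessians.
Under the hypotheses of a well-posed equality-constrained maximum, both the reduced
Hessian `∇²ℓ̃(p*)` and the bordered Hessian `H_L` are invertible, and
`(∇²ℓ̃(p*))⁻¹` equals the first `n` rows and `n` columns of `H_L⁻¹`. -/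
theorem inverse_hessian_equivalence (n m : ℕ)
    (ℓ : (Fin n → ℝ) × (Fin m → ℝ) → ℝ)
    (g : (Fin n → ℝ) × (Fin m → ℝ) → Fin m → ℝ)
    (pstar : Fin n → ℝ) (qstar : Fin m → ℝ)
    (zstar : (Fin n → ℝ) × (Fin m → ℝ)) (hzstar : zstar = (pstar, qstar))
    (hg0 : g zstar = 0)
    (hℓ : ContDiffAt ℝ 2 ℓ zstar) (hg : ContDiffAt ℝ 2 g zstar)
    (hGq : IsUnit ((jac n m g zstar).submatrix id Sum.inr).det)
    (Pstar : Set (Fin n → ℝ)) (hPopen : IsOpen Pstar) (hpmem : pstar ∈ Pstar)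
    (w : (Fin n → ℝ) → (Fin n → ℝ) × (Fin m → ℝ))
    (hw : ContDiffOn ℝ 2 w Pstar) (hwp : w pstar = zstar)
    (hconstr : ∀ p ∈ Pstar, g (w p) = 0)
    (hJw : jacW n m w pstar =
      Matrix.fromRows (1 : Matrix (Fin n) (Fin n) ℝ)
        (-(((jac n m g zstar).submatrix id Sum.inr)⁻¹ *
          (jac n m g zstar).submatrix id Sum.inl)))
    (lam : Fin m → ℝ)
    (hfoc : grad n m ℓ zstar + (jac n m g zstar)ᵀ.mulVec lam = 0)
    (hsoc : ∀ v : Fin n ⊕ Fin m → ℝ, v ≠ 0 → (jac n m g zstar).mulVec v = 0 →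
      v ⬝ᵥ (hess n m ℓ zstar +
        ∑ s, lam s • hess n m (fun z => g z s) zstar).mulVec v < 0) :
    IsUnit (hessRed n (fun p => ℓ (w p)) pstar).det ∧
    IsUnit (Matrix.fromBlocks
      (hess n m ℓ zstar + ∑ s, lam s • hess n m (fun z => g z s) zstar)
      (jac n m g zstar)ᵀ (jac n m g zstar) 0).det ∧
    (hessRed n (fun p => ℓ (w p)) pstar)⁻¹ =
      (Matrix.fromBlocks
        (hess n m ℓ zstar + ∑ s, lam s • hess n m (fun z => g z s) zstar)
        (jac n m g zstar)ᵀ (jac n m g zstar) 0)⁻¹.submatrix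
        (fun i : Fin n => Sum.inl (Sum.inl i)) (fun j : Fin n => Sum.inl (Sum.inl j)) := by
  have hwA : ContDiffAt ℝ 2 w pstar := hw.contDiffAt (hPopen.mem_nhds hpmem)
  have hgs : ∀ s, ContDiffAt ℝ 2 (fun z => g z s) zstar := contDiffAt_pi.1 hg
  set L : (Fin n → ℝ) × (Fin m → ℝ) → ℝ := fun z => ℓ z + ∑ s, lam s * g z s with hL
  have hLc : ContDiffAt ℝ 2 L zstar :=
    hℓ.add (ContDiffAt.sum fun s _ => contDiffAt_const.mul (hgs s))
  have hLd : HasFDerivAt L (fderiv ℝ ℓ zstar +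
      ∑ s, lam s • (ContinuousLinearMap.proj s).comp (fderiv ℝ g zstar)) zstar := by
    refine (hℓ.differentiableAt (by simp)).hasFDerivAt.add (HasFDerivAt.fun_sum fun s _ => ?_)
    exact ((hasFDerivAt_pi'.1 (hg.differentiableAt (by simp)).hasFDerivAt s).const_mul (lam s))
  have hL0 : fderiv ℝ L zstar = 0 := by
    rw [hLd.fderiv]
    refine ContinuousLinearMap.ext fun v => ?_
    rw [aux_expand n m v, map_sum]
    refine Finset.sum_eq_zero fun k _ => ?_
    rw [map_smul]
    have := congrFun hfoc k
    simp only [grad, jac, Pi.add_apply, Matrix.mulVec, dotProduct, Matrix.transpose_apply,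
      Pi.zero_apply] at this
    have h2 : (fderiv ℝ ℓ zstar +
      ∑ s, lam s • (ContinuousLinearMap.proj (R := ℝ) (φ := fun _ : Fin m => ℝ) s).comp
        (fderiv ℝ g zstar)) (dir n m k) = 0 := by
      rw [← this]
      simp [mul_comm]
    exact (congrArg _ h2).trans (smul_zero _)
  have hev : (fun p => ℓ (w p)) =ᶠ[nhds pstar] fun p => L (w p) := by
    filter_upwards [hPopen.mem_nhds hpmem] with p hp
    simp [hL, hconstr p hp]
  have hRed : hessRed n (fun p => ℓ (w p)) pstar =
      (jacW n m w pstar)ᵀ * hess n m L zstar * jacW n m w pstar := by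
    ext i j
    have h1 : hessRed n (fun p => ℓ (w p)) pstar i j =
        iteratedFDeriv ℝ 2 (fun p => L (w p)) pstar ![Pi.single i 1, Pi.single j 1] := by
      unfold hessRed
      rw [(hev.iteratedFDeriv ℝ 2).eq_of_nhds]
    rw [h1, aux_chain L w pstar (by rw [hwp]; exact hLc) hwA (by rw [hwp]; exact hL0), hwp]
    have hcol : ∀ j : Fin n, fderiv ℝ w pstar (Pi.single j 1) =
        ∑ k, jacW n m w pstar k j • dir n m k := by
      intro j
      exact aux_expand n m _
    rw [hcol i, hcol j]
    simp only [Matrix.mul_apply, Matrix.transpose_apply, hess, iteratedFDeriv_two_apply,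
      Matrix.cons_val_zero, Matrix.cons_val_one, map_sum, map_smul,
      _root_.sum_apply, _root_.smul_apply, smul_eq_mul,
      Finset.mul_sum, Finset.sum_mul]
    refine Finset.sum_congr rfl fun k _ => Finset.sum_congr rfl fun r _ => ?_
    ring
  rw [hRed, ← aux_lag n m ℓ g zstar hℓ hg lam]
  rw [← aux_lag n m ℓ g zstar hℓ hg lam] at hsoc
  exact aux_alg _ _ _ hGq hJw hsoc
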